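/- For every θ > 0, as ν → ∞ the COM-Poisson(θ,ν) probability mass function converges pointwise to the Bernoulli probability mass function with success probability θ/(1+θ): lim_{ν→∞} θ^0/((0!)^ν Z(θ,ν)) = 1/(1+θ), lim_{ν→∞} θ^1/((1!)^ν Z(θ,ν)) = θ/(1+θ), and for every integer m ≥ 2, lim_{ν→∞} θ^m/((m!)^ν Z(θ,ν)) = 0. -/

import Mathlib

open Filter

/-- The COM-Poisson normalizing constant `Z(θ,ν) = ∑_{j=0}^∞ θ^j/(j!)^ν`. -/
noncomputable def comPoissonZ (θ ν : ℝ) : ℝ :=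
  ∑' j : ℕ, θ ^ j / (j.factorial : ℝ) ^ ν

/-- The COM-Poisson probability mass function `P[M = m] = θ^m/((m!)^ν Z(θ,ν))`. -/
noncomputable def comPoissonPMF (θ ν : ℝ) (m : ℕ) : ℝ :=
  θ ^ m / ((m.factorial : ℝ) ^ ν * comPoissonZ θ ν)

/-- The terms with `m ≥ 2` vanish in the limit. -/
theorem comPoisson_term_tendsto (θ : ℝ) (m : ℕ) (hm : 2 ≤ m) :
    Tendsto (fun ν : ℝ => θ ^ m / (m.factorial : ℝ) ^ ν) atTop (nhds 0) := by
  have h1 : (1 : ℝ) < (m.factorial : ℝ) := by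
    exact_mod_cast Nat.one_lt_factorial.mpr (by omega)
  have h2 : Tendsto (fun ν : ℝ => (m.factorial : ℝ) ^ ν) atTop atTop :=
    tendsto_rpow_atTop_of_base_gt_one _ h1
  exact h2.const_div_atTop _

theorem comPoissonZ_tendsto (θ : ℝ) (hθ : 0 < θ) :
    Tendsto (fun ν : ℝ => comPoissonZ θ ν) atTop (nhds (1 + θ)) := by
  have key : Tendsto (fun ν : ℝ => ∑' j : ℕ, θ ^ j / (j.factorial : ℝ) ^ ν) atTop
      (nhds (∑' j : ℕ, if j < 2 then θ ^ j else 0)) := by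
    refine tendsto_tsum_of_dominated_convergence
      (bound := fun j : ℕ => θ ^ j / (j.factorial : ℝ)) (Real.summable_pow_div_factorial θ) ?_ ?_
    · intro j
      by_cases hj : j < 2
      · interval_cases j <;> simp
      · simp only [hj, if_false]
        exact comPoisson_term_tendsto θ j (by omega)
    · filter_upwards [eventually_ge_atTop (1 : ℝ)] with ν hν j
      have h1 : (1 : ℝ) ≤ (j.factorial : ℝ) := by
        exact_mod_cast Nat.succ_le_of_lt j.factorial_pos
      have h2 : (j.factorial : ℝ) ≤ (j.factorial : ℝ) ^ ν :=
        Real.self_le_rpow_of_one_le h1 hν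
      rw [Real.norm_of_nonneg (by positivity)]
      gcongr
  have hs : (∑' j : ℕ, if j < 2 then θ ^ j else 0) = 1 + θ := by
    rw [tsum_eq_sum (s := Finset.range 2)]
    · simp [Finset.sum_range_succ]
    · intro j hj
      simp at hj
      simp [hj]
  rw [hs] at key
  exact key

/-- For every `θ > 0`, as `ν → ∞` the COM-Poisson(θ,ν) pmf converges pointwise to the
Bernoulli pmf with success probability `θ/(1+θ)`:
`lim_{ν→∞} θ^0/((0!)^ν Z(θ,ν)) = 1/(1+θ)`, `lim_{ν→∞} θ^1/((1!)^ν Z(θ,ν)) = θ/(1+θ)`,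
and for every integer `m ≥ 2`, `lim_{ν→∞} θ^m/((m!)^ν Z(θ,ν)) = 0`. -/
theorem comPoissonPMF_tendsto_bernoulli (θ : ℝ) (hθ : 0 < θ) :
    Tendsto (fun ν : ℝ => comPoissonPMF θ ν 0) atTop (nhds (1 / (1 + θ))) ∧
    Tendsto (fun ν : ℝ => comPoissonPMF θ ν 1) atTop (nhds (θ / (1 + θ))) ∧
    ∀ m : ℕ, 2 ≤ m →
      Tendsto (fun ν : ℝ => comPoissonPMF θ ν m) atTop (nhds 0) := by
  have hZ := comPoissonZ_tendsto θ hθ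
  have hne : (1 + θ) ≠ 0 := by positivity
  refine ⟨?_, ?_, ?_⟩
  · simpa [comPoissonPMF] using hZ.inv₀ hne
  · simpa [comPoissonPMF, Pi.div_def] using (tendsto_const_nhds (x := θ)).div hZ hne
  · intro m hm
    simpa [comPoissonPMF, Pi.div_def, div_div] using (comPoisson_term_tendsto θ m hm).div hZ hne
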